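/- arXiv:1602.04456 — 3 statements merged into one kernel-verified Lean document; each statement's English description precedes it below -/
import Mathlib

section
/- Let n ≥ 1 and let g_1, …, g_{n²} ∈ M_n(ℂ) be unitary matrices that are pairwise orthogonal with respect to the normalized trace form, i.e. (1/n)·Tr(g_i^* g_j) = δ_{ij}. Then for every unitary matrix x ∈ M_n(ℂ), the n² × n² array (g_i x g_j^*)_{1≤i,j≤n²} is a magic basis of the n²-dimensional complex inner product space M_n(ℂ) equipped with the inner product ⟨A,B⟩ = (1/n)·Tr(A^*B): every row (g_i x g_1^*, …, g_i x g_{n²}^*) and every column (g_1 x g_j^*, …, g_{n²} x g_j^*) is an orthonormal basis of M_n(ℂ). -/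
open Matrix

/-- A family of matrices that is orthonormal for a multiple of the trace form is linearly
independent. -/
theorem linearIndependent_of_mul_trace_conjTranspose_mul {ι m : Type*} [DecidableEq ι]
    [Fintype m] (c : ℂ) (v : ι → Matrix m m ℂ)
    (hv : ∀ i j, c * trace ((v i)ᴴ * v j) = if i = j then 1 else 0) :
    LinearIndependent ℂ v := by
  rw [linearIndependent_iff']
  intro s a ha i hi
  have h : c * trace ((v i)ᴴ * ∑ j ∈ s, a j • v j) = ∑ j ∈ s, a j * if i = j then 1 else 0 := by
    simp only [← hv, trace_sum, Matrix.mul_smul, trace_smul, smul_eq_mul,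
      Finset.mul_sum, mul_left_comm c]
  simpa [ha, hi] using h.symm

/-- A family of `(card m)²` matrices that is orthonormal for a multiple of the trace form spans
the matrix algebra. -/
theorem span_range_eq_top_of_mul_trace_conjTranspose_mul {ι m : Type*} [Fintype ι]
    [DecidableEq ι] [Fintype m] (hcard : Fintype.card ι = Fintype.card m ^ 2) (c : ℂ)
    (v : ι → Matrix m m ℂ)
    (hv : ∀ i j, c * trace ((v i)ᴴ * v j) = if i = j then 1 else 0) :
    Submodule.span ℂ (Set.range v) = ⊤ := by
  have hli := linearIndependent_of_mul_trace_conjTranspose_mul c v hv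
  refine hli.span_eq_top_of_card_eq_finrank' ?_
  rw [hcard, Module.finrank_matrix, Module.finrank_self, mul_one, sq]

/-- Left multiplication by a unitary matrix preserves the trace form. -/
theorem trace_conjTranspose_unitary_mul {m : Type*} [Fintype m] [DecidableEq m]
    {u : Matrix m m ℂ} (hu : u ∈ unitaryGroup m ℂ) (a b : Matrix m m ℂ) :
    trace ((u * a)ᴴ * (u * b)) = trace (aᴴ * b) := by
  have h : uᴴ * u = 1 := mem_unitaryGroup_iff'.mp hu
  rw [conjTranspose_mul, Matrix.mul_assoc, ← Matrix.mul_assoc uᴴ, h, Matrix.one_mul]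

/-- Right multiplication by a unitary matrix preserves the trace form. -/
theorem trace_conjTranspose_mul_unitary {m : Type*} [Fintype m] [DecidableEq m]
    {u : Matrix m m ℂ} (hu : u ∈ unitaryGroup m ℂ) (a b : Matrix m m ℂ) :
    trace ((a * u)ᴴ * (b * u)) = trace (aᴴ * b) := by
  have h : u * uᴴ = 1 := mem_unitaryGroup_iff.mp hu
  rw [trace_mul_comm, conjTranspose_mul, Matrix.mul_assoc, ← Matrix.mul_assoc u, h,
    Matrix.one_mul, trace_mul_comm]

/-- If `g 1, …, g (n²)` are unitary `n×n` matrices, pairwise orthogonal for the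
normalized trace form, then for any unitary `x` the array `(g i * x * (g j)ᴴ)` is a
magic basis of `M_n(ℂ)` with the inner product `⟨A,B⟩ = (1/n)·Tr(Aᴴ·B)`: every row and
every column is an orthonormal basis. -/
theorem magicBasis_of_pairwiseOrthogonal_unitaries (n : ℕ) (hn : 1 ≤ n)
    (g : Fin (n ^ 2) → Matrix (Fin n) (Fin n) ℂ)
    (hg : ∀ i, g i ∈ Matrix.unitaryGroup (Fin n) ℂ)
    (horth : ∀ i j, (1 / (n : ℂ)) * Matrix.trace ((g i)ᴴ * g j) =
      if i = j then 1 else 0)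
    (x : Matrix (Fin n) (Fin n) ℂ) (hx : x ∈ Matrix.unitaryGroup (Fin n) ℂ) :
    (∀ i, (∀ j j', (1 / (n : ℂ)) *
        Matrix.trace ((g i * x * (g j)ᴴ)ᴴ * (g i * x * (g j')ᴴ)) =
          if j = j' then 1 else 0) ∧
      Submodule.span ℂ (Set.range fun j => g i * x * (g j)ᴴ) = ⊤) ∧
    (∀ j, (∀ i i', (1 / (n : ℂ)) *
        Matrix.trace ((g i * x * (g j)ᴴ)ᴴ * (g i' * x * (g j)ᴴ)) =
          if i = i' then 1 else 0) ∧
      Submodule.span ℂ (Set.range fun i => g i * x * (g j)ᴴ) = ⊤) := by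
  have hrow : ∀ i j j', (1 / (n : ℂ)) *
      trace ((g i * x * (g j)ᴴ)ᴴ * (g i * x * (g j')ᴴ)) = if j = j' then 1 else 0 := by
    intro i j j'
    rw [trace_conjTranspose_unitary_mul (mul_mem (hg i) hx), conjTranspose_conjTranspose,
      trace_mul_comm, horth]
    simp only [eq_comm]
  have hcol : ∀ j i i', (1 / (n : ℂ)) *
      trace ((g i * x * (g j)ᴴ)ᴴ * (g i' * x * (g j)ᴴ)) = if i = i' then 1 else 0 := by
    intro j i i'
    have hj : (g j)ᴴ ∈ unitaryGroup (Fin n) ℂ := Unitary.star_mem (hg j)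
    rw [trace_conjTranspose_mul_unitary hj,
      trace_conjTranspose_mul_unitary hx, horth]
  have hcard : Fintype.card (Fin (n ^ 2)) = Fintype.card (Fin n) ^ 2 := by simp
  exact ⟨fun i => ⟨hrow i,
      span_range_eq_top_of_mul_trace_conjTranspose_mul hcard _ _ (hrow i)⟩,
    fun j => ⟨hcol j, span_range_eq_top_of_mul_trace_conjTranspose_mul hcard _ _ (hcol j)⟩⟩
end

section
/- Let N, p, r ≥ 1, let V be a complex inner product space, and let x_{ij} ∈ V for 1 ≤ i, j ≤ N be arbitrary vectors. Define T_p ∈ ℂ^{N^p × N^p}, with rows and columns indexed by p-tuples from {1,…,N}, by (T_p)_{(i_1…i_p),(j_1…j_p)} = (1/N)·⟨x_{i_1j_1}, x_{i_2j_2}⟩⟨x_{i_2j_2}, x_{i_3j_3}⟩⋯⟨x_{i_pj_p}, x_{i_1j_1}⟩, and define G ∈ ℂ^{N^r × N^r}, with rows and columns indexed by r-tuples from {1,…,N}, by G_{(i_1…i_r),(j_1…j_r)} = Π_{k=1}^{r} ⟨x_{i_k i_{k+1}}, x_{j_k j_{k+1}}⟩, where indices are cyclic (i_{r+1} = i_1,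 j_{r+1} = j_1). Then Tr(T_p^r) = (1/N^r)·Tr(G^p). -/
open scoped InnerProductSpace

namespace Matrix

variable {ι R : Type*} [Fintype ι] [DecidableEq ι] [CommSemiring R]

/-- Expansion of the entries of a matrix power as a sum over walks, tested against an arbitrary
weight `F` on the end points. -/
theorem sum_walk_mul_eq_sum_pow_mul (A : Matrix ι ι R) (n : ℕ) (F : ι → ι → R) :
    ∑ f : Fin (n + 1) → ι,
        (∏ k : Fin n, A (f k.castSucc) (f k.succ)) * F (f 0) (f (Fin.last n)) =
      ∑ i, ∑ j, (A ^ n) i j * F i j := by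
  induction n generalizing F with
  | zero =>
    rw [← (Equiv.funUnique (Fin 1) ι).symm.sum_comp]
    simp [Matrix.one_apply]
  | succ n ih =>
    rw [← (Fin.consEquiv fun _ : Fin (n + 2) => ι).sum_comp, Fintype.sum_prod_type]
    refine Finset.sum_congr rfl fun i _ => ?_
    have h := ih fun a b => A i a * F i b
    calc
      _ = ∑ g : Fin (n + 1) → ι, (∏ k : Fin n, A (g k.castSucc) (g k.succ)) *
            (A i (g 0) * F i (g (Fin.last n))) := by
        refine Finset.sum_congr rfl fun g _ => ?_
        simp only [Fin.consEquiv_apply, Fin.prod_univ_succ, Fin.castSucc_zero, Fin.cons_zero,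
          Fin.cons_succ, ← Fin.succ_castSucc, ← Fin.succ_last]
        ring
      _ = _ := h
      _ = _ := by
        rw [Finset.sum_comm]
        refine Finset.sum_congr rfl fun j _ => ?_
        rw [pow_succ', Matrix.mul_apply, Finset.sum_mul]
        exact Finset.sum_congr rfl fun a _ => by ring

/-- The trace of a matrix power is the sum over closed walks. -/
theorem trace_pow_succ_eq_sum_prod (A : Matrix ι ι R) (n : ℕ) :
    trace (A ^ (n + 1)) = ∑ f : Fin (n + 1) → ι, ∏ k, A (f k) (f (k + 1)) := by
  have h := sum_walk_mul_eq_sum_pow_mul A n fun i j => A j i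
  simp only [Fin.prod_univ_castSucc, Fin.coeSucc_eq_succ, Fin.last_add_one]
  rw [h, pow_succ]
  simp [Matrix.trace, Matrix.mul_apply]

end Matrix

/-- The trace identity `Tr(T_p^r) = (1/N^r)·Tr(G^p)` relating the moment matrix `T_p`
of an array of vectors `x : Fin N → Fin N → V` to the Gram matrix `G` of the associated
tensor product vectors.  Here `p` and `r` range over the positive integers, encoded as
`p + 1` and `r + 1`. -/
theorem trace_Tp_pow_eq_trace_gram_pow (N p r : ℕ) (hN : 1 ≤ N) {V : Type*}
    [NormedAddCommGroup V] [InnerProductSpace ℂ V] (x : Fin N → Fin N → V) :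
    Matrix.trace
      ((Matrix.of fun I J : Fin (p + 1) → Fin N =>
          (1 / (N : ℂ)) * ∏ k, ⟪x (I k) (J k), x (I (k + 1)) (J (k + 1))⟫_ℂ) ^ (r + 1)) =
    (1 / (N : ℂ) ^ (r + 1)) * Matrix.trace
      ((Matrix.of fun I J : Fin (r + 1) → Fin N =>
          ∏ k, ⟪x (I k) (I (k + 1)), x (J k) (J (k + 1))⟫_ℂ) ^ (p + 1)) := by
  simp only [Matrix.trace_pow_succ_eq_sum_prod, Matrix.of_apply, Finset.prod_mul_distrib,
    Finset.prod_const, Finset.card_univ, Fintype.card_fin, ← Finset.mul_sum, one_div, inv_pow]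
  congr 1
  rw [← (Equiv.piComm fun (_ : Fin (p + 1)) (_ : Fin (r + 1)) => Fin N).sum_comp]
  exact Finset.sum_congr rfl fun g _ => Finset.prod_comm
end

section
/- Let P, Q, R ∈ M_K(ℂ) be orthogonal projections (self-adjoint idempotent matrices) such that PQ = 0, the ranges of P and R intersect trivially (range(P) ∩ range(R) = {0}), and P + R is invertible. Let (P+R)^{-1/2} denote the inverse of the unique positive semidefinite square root of P + R, and set P' = (P+R)^{-1/2} P (P+R)^{-1/2}. Then Tr(PR) and Tr(P'Q) are nonnegative real numbers and Tr(PR) ≥ Tr(P'Q). -/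
open Matrix
open scoped ComplexOrder

section

variable {n : Type*} [Fintype n]

lemma Matrix.trace_two_mul [DecidableEq n] (M : Matrix n n ℂ) :
    (2 * M).trace = 2 * M.trace := by
  rw [two_mul, trace_add, two_mul]

lemma Matrix.PosSemidef.trace_mul_nonneg [DecidableEq n] {X Y : Matrix n n ℂ}
    (hX : X.PosSemidef) (hY : Y.PosSemidef) : 0 ≤ (X * Y).trace := by
  open scoped MatrixOrder in
  obtain ⟨B, rfl⟩ := CStarAlgebra.nonneg_iff_eq_star_mul_self.mp hX.nonneg
  rw [star_eq_conjTranspose, mul_assoc, trace_mul_comm]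
  exact (hY.mul_mul_conjTranspose_same B).trace_nonneg

lemma Matrix.PosSemidef.commute_of_commute_mul_self [DecidableEq n] {X Y : Matrix n n ℂ}
    (hX : X.PosSemidef) (h : Commute (X * X) Y) : Commute X Y := by
  open scoped MatrixOrder in
  rw [← CFC.sqrt_mul_self X hX.nonneg, CFC.sqrt_eq_cfc]
  exact h.cfc_nnreal _

/-- An idempotent Hermitian matrix is positive semidefinite. -/
lemma Matrix.IsHermitian.posSemidef_of_mul_self {E : Matrix n n ℂ} (hE : E.IsHermitian)
    (h : E * E = E) : E.PosSemidef := by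
  have := posSemidef_conjTranspose_mul_self E
  rwa [hE.eq, h] at this

/-- If `Y` is positive semidefinite and `X² + Y² = 2`, then `X` and `Y` commute. -/
lemma Matrix.PosSemidef.commute_of_mul_self_add_mul_self_eq_two [DecidableEq n]
    {X Y : Matrix n n ℂ} (hY : Y.PosSemidef) (h : X * X + Y * Y = 2) :
    Commute X Y := by
  refine (hY.commute_of_commute_mul_self ?_).symm
  rw [eq_sub_of_add_eq' h]
  exact ((Commute.ofNat_right X 2).sub_right ((Commute.refl X).mul_right (Commute.refl X))).symm

/-- If `X, Y ≥ 0` and `X² + Y² = 2`, then `1 - XY = (X - Y)² / 2`, so that `0 ≤ XY ≤ 1` and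
`(XY)² ≤ XY`. -/
lemma Matrix.PosSemidef.trace_mul_mul_self_le_trace_mul [DecidableEq n]
    {X Y : Matrix n n ℂ} (hX : X.PosSemidef) (hY : Y.PosSemidef) (h : X * X + Y * Y = 2) :
    (X * X * (Y * Y)).trace ≤ (X * Y).trace := by
  have hc : Y * X = X * Y := (hY.commute_of_mul_self_add_mul_self_eq_two h).eq.symm
  have hD : (X - Y)ᴴ = X - Y := by rw [conjTranspose_sub, hX.1.eq, hY.1.eq]
  have hDX : ((X - Y) * X * (X - Y)).PosSemidef := by
    simpa only [hD] using hX.conjTranspose_mul_mul_same (X - Y)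
  have key := hDX.trace_mul_nonneg hY
  have hDXY : (X - Y) * X * (X - Y) * Y = 2 * (X * Y - X * X * (Y * Y)) := by
    have hcD : X * (X - Y) = (X - Y) * X := by rw [mul_sub, sub_mul, hc]
    have hDD : (X - Y) * (X - Y) = 2 - 2 * (X * Y) := by
      rw [← h, sub_mul, mul_sub, mul_sub, hc, h, eq_sub_of_add_eq' h]
      noncomm_ring
    have hXYXY : X * Y * (X * Y) = X * X * (Y * Y) := by
      rw [mul_assoc, ← mul_assoc Y, hc]
      simp only [mul_assoc]
    rw [mul_assoc (X - Y) X, hcD, ← mul_assoc, hDD, mul_assoc]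
    calc (2 - 2 * (X * Y)) * (X * Y) = 2 * (X * Y - X * Y * (X * Y)) := by noncomm_ring
      _ = _ := by rw [hXYXY]
  rw [hDXY, trace_two_mul, trace_sub] at key
  rw [Complex.le_def] at key ⊢
  simp only [Complex.zero_re, Complex.zero_im, Complex.mul_re, Complex.mul_im, Complex.sub_re,
    Complex.sub_im, Complex.re_ofNat, Complex.im_ofNat] at key
  constructor <;> linarith [key.1, key.2]

/-- If `P` and `R` have trivially intersecting ranges and `P + R` is invertible, then
the parallel sum `P (P + R)⁻¹ R` vanishes, that is, `P (P + R)⁻¹ P = P`. -/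
lemma Matrix.mul_inv_add_mul_self_of_disjoint_range [DecidableEq n] {P R : Matrix n n ℂ}
    (hrange : LinearMap.range (mulVecLin P) ⊓ LinearMap.range (mulVecLin R) = ⊥)
    (hinv : IsUnit (P + R).det) : P * (P + R)⁻¹ * P = P := by
  have hPR : P * (P + R)⁻¹ * P + P * (P + R)⁻¹ * R = P := by
    rw [← mul_add, nonsing_inv_mul_cancel_right _ _ hinv]
  have hRR : P * (P + R)⁻¹ * R + R * (P + R)⁻¹ * R = R := by
    rw [← add_mul, ← add_mul, mul_nonsing_inv _ hinv, one_mul]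
  have hzero : P * (P + R)⁻¹ * R = 0 := by
    refine ext_of_mulVec_single fun i => ?_
    rw [zero_mulVec, ← Submodule.mem_bot ℂ, ← hrange]
    refine ⟨⟨((P + R)⁻¹ * R) *ᵥ Pi.single i 1, ?_⟩,
      ⟨(1 - (P + R)⁻¹ * R) *ᵥ Pi.single i 1, ?_⟩⟩
    · rw [mulVecLin_apply, mulVec_mulVec, mul_assoc]
    · rw [mulVecLin_apply, mulVec_mulVec, mul_sub, mul_one, ← mul_assoc,
        ← eq_sub_iff_add_eq.mpr hRR]
  rw [hzero, add_zero] at hPR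
  exact hPR

end

/-- The case `S = 0` of the trace inequality for the Sinkhorn-type orthogonalization:
if `P, Q, R` are orthogonal projections with `PQ = 0`, `range(P) ∩ range(R) = {0}` and
`P + R` invertible, and `P' = (P+R)^{-1/2} P (P+R)^{-1/2}` (with `(P+R)^{-1/2}` the
inverse of the unique positive semidefinite square root of `P + R`), then `Tr(PR)` and
`Tr(P'Q)` are nonnegative real numbers and `Tr(PR) ≥ Tr(P'Q)`. -/
theorem trace_inequality_sinkhorn (K : ℕ) (P Q R : Matrix (Fin K) (Fin K) ℂ)
    (hP : Pᴴ = P ∧ P * P = P) (hQ : Qᴴ = Q ∧ Q * Q = Q) (hR : Rᴴ = R ∧ R * R = R)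
    (hPQ : P * Q = 0)
    (hrange : LinearMap.range (Matrix.mulVecLin P) ⊓ LinearMap.range (Matrix.mulVecLin R) = ⊥)
    (hinv : IsUnit (P + R).det)
    (S : Matrix (Fin K) (Fin K) ℂ) (hS : S.PosSemidef) (hSS : S * S = P + R) :
    (Matrix.trace (P * R)).im = 0 ∧
    (Matrix.trace (S⁻¹ * P * S⁻¹ * Q)).im = 0 ∧
    0 ≤ (Matrix.trace (S⁻¹ * P * S⁻¹ * Q)).re ∧
    (Matrix.trace (S⁻¹ * P * S⁻¹ * Q)).re ≤ (Matrix.trace (P * R)).re := by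
  obtain ⟨hPs, hPP⟩ := hP
  obtain ⟨hQs, hQQ⟩ := hQ
  obtain ⟨hRs, hRR⟩ := hR
  have hPpos : P.PosSemidef := IsHermitian.posSemidef_of_mul_self hPs hPP
  have hQpos : Q.PosSemidef := IsHermitian.posSemidef_of_mul_self hQs hQQ
  have hRpos : R.PosSemidef := IsHermitian.posSemidef_of_mul_self hRs hRR
  have hQP : Q * P = 0 := by
    rw [← hQs, ← hPs, ← conjTranspose_mul, hPQ, conjTranspose_zero]
  have hcompl : (1 - P - Q).PosSemidef := by
    refine IsHermitian.posSemidef_of_mul_self ?_ ?_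
    · rw [IsHermitian, conjTranspose_sub, conjTranspose_sub, conjTranspose_one, hPs, hQs]
    · simp only [sub_mul, mul_sub, one_mul, mul_one, hPP, hQQ, hPQ, hQP]
      abel
  have hSdet : IsUnit S.det := by
    rw [← hSS, det_mul] at hinv
    exact isUnit_of_mul_isUnit_left hinv
  have hparallel : P * S⁻¹ * (S⁻¹ * P) = P := by
    have := mul_inv_add_mul_self_of_disjoint_range hrange hinv
    rwa [← hSS, Matrix.mul_inv_rev, ← mul_assoc, mul_assoc] at this
  have hTs : (S⁻¹)ᴴ = S⁻¹ := hS.1.inv.eq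
  have hTS : S⁻¹ * S = 1 := nonsing_inv_mul S hSdet
  have hST : S * S⁻¹ = 1 := mul_nonsing_inv S hSdet
  generalize S⁻¹ = T at *
  have hP'pos : (T * P * T).PosSemidef := by
    simpa only [hTs] using hPpos.conjTranspose_mul_mul_same T
  obtain ⟨J, hJ⟩ : ∃ J, J = 2 * (T * P * T) - 1 := ⟨_, rfl⟩
  have hJs : Jᴴ = J := by
    rw [hJ, two_mul, conjTranspose_sub, conjTranspose_add, hP'pos.1.eq, conjTranspose_one]
  have hP'P' : T * P * T * (T * P * T) = T * P * T := by
    calc T * P * T * (T * P * T) = T * (P * T * (T * P)) * T := by simp only [mul_assoc]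
      _ = T * P * T := by rw [hparallel]
  have hJJ : J * J = 1 := by
    calc J * J = 4 * (T * P * T * (T * P * T)) - 4 * (T * P * T) + 1 := by rw [hJ]; noncomm_ring
      _ = 1 := by rw [hP'P']; abel
  have hJS : J * S = T * (P - R) := by
    have hTPR : T * P + T * R = S := by rw [← mul_add, ← hSS, ← mul_assoc, hTS, one_mul]
    calc J * S = 2 * (T * P * (T * S)) - S := by rw [hJ]; noncomm_ring
      _ = 2 * (T * P) - (T * P + T * R) := by rw [hTS, mul_one, hTPR]
      _ = T * (P - R) := by noncomm_ring
  have hSJ : S * J = (P - R) * T := by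
    have := congrArg conjTranspose hJS
    rwa [conjTranspose_mul, conjTranspose_mul, conjTranspose_sub, hJs, hTs, hPs, hRs, hS.1.eq]
      at this
  have hPR2 : (P - R) * (P - R) = 2 * (P + R) - (P + R) * (P + R) := by
    simp only [sub_mul, mul_sub, add_mul, mul_add, two_mul, hPP, hRR]
    abel
  have hY : (J * S * J).PosSemidef := by
    simpa only [hJs] using hS.conjTranspose_mul_mul_same J
  have hYY : J * S * J * (J * S * J) = 2 - S * S := by
    calc J * S * J * (J * S * J) = J * S * (J * J) * (S * J) := by simp only [mul_assoc]
      _ = T * ((P - R) * (P - R)) * T := by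
        rw [hJJ, mul_one, hJS, hSJ]; simp only [mul_assoc]
      _ = 2 * (T * S * (S * T)) - T * S * S * S * (S * T) := by
        rw [hPR2, ← hSS]; noncomm_ring
      _ = 2 - S * S := by simp only [hTS, hST, one_mul, mul_one]
  have hle := hS.trace_mul_mul_self_le_trace_mul hY (by rw [hYY, add_sub_cancel])
  have htrl : (S * S * (J * S * J * (J * S * J))).trace = (P + R).trace - 2 * (P * R).trace := by
    have : S * S * (2 - S * S) = P + R - P * R - R * P := by
      rw [hSS]
      simp only [mul_sub, add_mul, mul_add, mul_two, hPP, hRR]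
      abel
    rw [hYY, this, trace_sub, trace_sub, trace_mul_comm R P]
    ring
  have htrr : (S * (J * S * J)).trace =
      4 * (T * P * T * P).trace - 4 * P.trace + (P + R).trace := by
    have hSJ' : S * J = 2 * (P * T) - S := by
      calc S * J = 2 * (S * T * P * T) - S := by rw [hJ]; noncomm_ring
        _ = 2 * (P * T) - S := by rw [hST, one_mul]
    have hSJSJ : S * (J * S * J) =
        2 * (2 * (P * T * P * T)) - 2 * P - 2 * (S * (P * T)) + (P + R) := by
      calc S * (J * S * J) = S * J * (S * J) := by simp only [mul_assoc]
        _ = 2 * (2 * (P * T * P * T)) - 2 * (P * (T * S)) - 2 * (S * (P * T)) + S * S := by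
          rw [hSJ']; noncomm_ring
        _ = _ := by rw [hTS, hSS, mul_one]
    have hcyc : (P * T * P * T).trace = (T * P * T * P).trace := by
      rw [trace_mul_comm]; simp only [mul_assoc]
    have hSPT : (S * (P * T)).trace = P.trace := by
      rw [trace_mul_comm, mul_assoc, hTS, mul_one]
    rw [hSJSJ, trace_add, trace_sub, trace_sub]
    simp only [trace_two_mul, hcyc, hSPT]
    ring
  have htrP' : (T * P * T).trace = P.trace := by
    calc (T * P * T).trace = (T * P * (P * T)).trace := by
          rw [mul_assoc T P (P * T), ← mul_assoc P, hPP, mul_assoc]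
      _ = P.trace := by rw [trace_mul_comm, hparallel]
  have hcomp := hP'pos.trace_mul_nonneg hcompl
  rw [mul_sub, mul_sub, mul_one, trace_sub, trace_sub, htrP'] at hcomp
  rw [htrl, htrr] at hle
  have hPRnn := hPpos.trace_mul_nonneg hRpos
  have hP'Qnn := hP'pos.trace_mul_nonneg hQpos
  rw [Complex.le_def] at hle hcomp hPRnn hP'Qnn
  simp at hle hcomp hPRnn hP'Qnn
  refine ⟨hPRnn.2.symm, hP'Qnn.2.symm, hP'Qnn.1, ?_⟩
  linarith [hle.1, hcomp.1, hPRnn.1]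
end
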